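/- arXiv:2201.12440 — 7 statements merged into one kernel-verified Lean document; each statement's English description precedes it below -/
import Mathlib

section
/- Let X and Y be measurable spaces, d_X : X × X → [0, ∞] a measurable function, and define the distance d on X × Y by d((x₁,y₁),(x₂,y₂)) = d_X(x₁,x₂) if y₁ = y₂ and d((x₁,y₁),(x₂,y₂)) = ∞ otherwise. Let S be a Markov kernel assigning to each x ∈ X a probability measure S(x) on X, let h : X × Y → [0,1] be measurable, and define the smoothed function h̄(x,y) = ∫ h(x',y) dS(x)(x'). Let ψ : [0,∞] → [0,1] be a concave, nondecreasing function such that TV(S(x₁), S(x₂)) ≤ ψ(d_X(x₁,x₂)) for all x₁, x₂ ∈ X, where TV denotes the total variation distance. If D and D̃ are probability measures on X × Y and γ is a coupling of D and D̃ (a probability measure on (X × Y) × (X × Y) whose first marginal is D and second marginal is D̃) satisfying ∫ d(τ₁,τ₂) dγ(τ₁,τ₂) ≤ ε for some finite ε ≥ 0, then |∫ h̄ dD − ∫ h̄ dD̃| ≤ ψ(ε). -/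
open MeasureTheory ProbabilityTheory
open scoped Classical ENNReal NNReal

/-- Total variation distance between two measures:
the supremum over measurable sets `A` of `|μ A - ν A|`. -/
noncomputable def TV {α : Type*} [MeasurableSpace α] (μ ν : Measure α) : ℝ :=
  ⨆ A : {A : Set α // MeasurableSet A}, |(μ A.1).toReal - (ν A.1).toReal|

/-- A convex function on a subset of the line has a supporting line at each interior point. -/
theorem ConvexOn.exists_supporting_line {s : Set ℝ} {f : ℝ → ℝ} {m : ℝ}
    (hf : ConvexOn ℝ s f) (hm : m ∈ interior s) :
    ∃ c : ℝ, ∀ t ∈ s, f m + c * (t - m) ≤ f t := by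
  refine ⟨derivWithin f (Set.Ioi m) m, fun t ht ↦ ?_⟩
  rcases lt_trichotomy t m with h | h | h
  · have h1 := (hf.slope_le_leftDeriv_of_mem_interior ht hm h).trans
      (hf.leftDeriv_le_rightDeriv_of_mem_interior hm)
    rw [slope_def_field, div_le_iff₀ (sub_pos.2 h)] at h1
    linarith
  · simp [h]
  · have h1 := hf.rightDeriv_le_slope_of_mem_interior hm ht h
    rw [slope_def_field, le_div_iff₀ (sub_pos.2 h)] at h1
    linarith

/-- A monotone concave function on `[0, ∞]` lies below a line of nonnegative slope touching it at
a given positive finite point. -/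
theorem ConcaveOn.exists_nonneg_supporting_line {ψ : ℝ≥0∞ → ℝ} (hmono : Monotone ψ)
    (hconc : ConcaveOn ℝ≥0 (Set.univ : Set ℝ≥0∞) ψ) {ε : ℝ≥0∞} (hε₀ : ε ≠ 0) (hε : ε ≠ ⊤) :
    ∃ c : ℝ, 0 ≤ c ∧ ∀ t : ℝ≥0∞, t ≠ ⊤ → ψ t ≤ ψ ε + c * (t.toReal - ε.toReal) := by
  have hpos : 0 < ε.toReal := ENNReal.toReal_pos hε₀ hε
  have hconv : ConvexOn ℝ (Set.Ici (0 : ℝ)) (fun t ↦ -ψ (ENNReal.ofReal t)) := by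
    refine ⟨convex_Ici 0, fun x hx y hy a b ha hb hab ↦ ?_⟩
    lift a to ℝ≥0 using ha
    lift b to ℝ≥0 using hb
    have h := hconc.2 (Set.mem_univ (ENNReal.ofReal x)) (Set.mem_univ (ENNReal.ofReal y))
      (zero_le : 0 ≤ a) (zero_le : 0 ≤ b) (by exact_mod_cast hab)
    have hcomb : a • ENNReal.ofReal x + b • ENNReal.ofReal y
        = ENNReal.ofReal (a * x + b * y) := by
      rw [ENNReal.ofReal_add (mul_nonneg a.coe_nonneg hx) (mul_nonneg b.coe_nonneg hy),
        ENNReal.ofReal_mul a.coe_nonneg, ENNReal.ofReal_mul b.coe_nonneg, ENNReal.smul_def,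
        ENNReal.smul_def, smul_eq_mul, smul_eq_mul, ENNReal.ofReal_coe_nnreal, ENNReal.ofReal_coe_nnreal]
    rw [hcomb] at h
    simp only [NNReal.smul_def, smul_eq_mul] at h ⊢
    linarith
  obtain ⟨c, hc⟩ := hconv.exists_supporting_line (m := ε.toReal) (by simpa using hpos)
  refine ⟨-c, ?_, fun t ht ↦ ?_⟩
  · have h1 := hc (ε.toReal + 1) (Set.mem_Ici.2 (by positivity))
    have h2 := hmono (ENNReal.ofReal_le_ofReal (le_add_of_nonneg_right zero_le_one :
      ε.toReal ≤ ε.toReal + 1))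
    linarith
  · have h1 := hc t.toReal ENNReal.toReal_nonneg
    rw [ENNReal.ofReal_toReal hε, ENNReal.ofReal_toReal ht] at h1
    linarith

/-- Jensen's inequality for a bounded monotone concave function on `[0, ∞]`, which need not be
continuous at `0`. -/
theorem integral_comp_le_of_concaveOn_of_lintegral_le {Ω : Type*} [MeasurableSpace Ω]
    {μ : Measure Ω} [IsProbabilityMeasure μ] {f : Ω → ℝ≥0∞} (hf : Measurable f)
    {ψ : ℝ≥0∞ → ℝ} (hmono : Monotone ψ)
    (hconc : ConcaveOn ℝ≥0 (Set.univ : Set ℝ≥0∞) ψ) (hint : Integrable (fun ω ↦ ψ (f ω)) μ)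
    {ε : ℝ≥0∞} (hε : ε ≠ ⊤) (hle : ∫⁻ ω, f ω ∂μ ≤ ε) :
    ∫ ω, ψ (f ω) ∂μ ≤ ψ ε := by
  rcases eq_or_ne ε 0 with rfl | hε₀
  · have h0 : f =ᵐ[μ] 0 := (lintegral_eq_zero_iff hf).1 (le_antisymm hle zero_le)
    have h1 : (fun ω ↦ ψ (f ω)) =ᵐ[μ] fun _ ↦ ψ 0 := by
      filter_upwards [h0] with ω hω
      rw [hω, Pi.zero_apply]
    rw [integral_congr_ae h1]
    simp
  obtain ⟨c, hc₀, hc⟩ := ConcaveOn.exists_nonneg_supporting_line hmono hconc hε₀ hε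
  have hlt : ∫⁻ ω, f ω ∂μ ≠ ⊤ := (hle.trans_lt hε.lt_top).ne
  have hfin : ∀ᵐ ω ∂μ, f ω < ⊤ := ae_lt_top hf hlt
  have hfint : Integrable (fun ω ↦ (f ω).toReal) μ := integrable_toReal_of_lintegral_ne_top
    hf.aemeasurable hlt
  have hmean : ∫ ω, (f ω).toReal ∂μ ≤ ε.toReal := by
    rw [integral_toReal hf.aemeasurable hfin]
    exact ENNReal.toReal_mono hε hle
  have hline : Integrable (fun ω ↦ c * ((f ω).toReal - ε.toReal)) μ :=
    (hfint.sub (integrable_const _)).const_mul c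
  calc ∫ ω, ψ (f ω) ∂μ ≤ ∫ ω, (ψ ε + c * ((f ω).toReal - ε.toReal)) ∂μ := by
        refine integral_mono_ae hint ((integrable_const _).add hline) ?_
        filter_upwards [hfin] with ω hω using hc _ hω.ne
    _ = ψ ε + c * (∫ ω, (f ω).toReal ∂μ - ε.toReal) := by
        rw [integral_add (integrable_const _) hline, integral_const_mul,
          integral_sub hfint (integrable_const _)]
        simp
    _ ≤ ψ ε := by
        have := mul_nonneg hc₀ (sub_nonneg.2 hmean)
        linarith

theorem abs_measureReal_sub_le_TV {α : Type*} [MeasurableSpace α] (μ ν : Measure α)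
    [IsProbabilityMeasure μ] [IsProbabilityMeasure ν] {A : Set α} (hA : MeasurableSet A) :
    |μ.real A - ν.real A| ≤ TV μ ν := by
  refine le_ciSup (f := fun A : {A : Set α // MeasurableSet A} ↦
    |(μ A.1).toReal - (ν A.1).toReal|) ⟨1, ?_⟩ ⟨A, hA⟩
  rintro _ ⟨B, rfl⟩
  have h1 : μ.real B.1 ≤ 1 := measureReal_le_one
  have h2 : ν.real B.1 ≤ 1 := measureReal_le_one
  have h3 : 0 ≤ μ.real B.1 := measureReal_nonneg
  have h4 : 0 ≤ ν.real B.1 := measureReal_nonneg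
  change |μ.real B.1 - ν.real B.1| ≤ 1
  exact abs_sub_le_iff.2 ⟨by linarith, by linarith⟩

/-- Integrals of a `[0, 1]`-valued function against two probability measures differ by at most
their total variation distance. -/
theorem abs_integral_sub_integral_le_TV {α : Type*} [MeasurableSpace α] (μ ν : Measure α)
    [IsProbabilityMeasure μ] [IsProbabilityMeasure ν] {g : α → ℝ} (hg : Measurable g)
    (hrange : ∀ a, g a ∈ Set.Icc (0 : ℝ) 1) :
    |∫ a, g a ∂μ - ∫ a, g a ∂ν| ≤ TV μ ν := by
  have hlayer : ∀ (ρ : Measure α) [IsProbabilityMeasure ρ],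
      ∫ a, g a ∂ρ = ∫ t in Set.Ioc (0 : ℝ) 1, ρ.real {a | t ≤ g a} := fun ρ _ ↦
    (Integrable.of_mem_Icc 0 1 hg.aemeasurable
      (ae_of_all _ hrange)).integral_eq_integral_Ioc_meas_le
      (ae_of_all _ fun a ↦ (hrange a).1) (ae_of_all _ fun a ↦ (hrange a).2)
  have hint : ∀ (ρ : Measure α) [IsProbabilityMeasure ρ],
      Integrable (fun t ↦ ρ.real {a | t ≤ g a}) (volume.restrict (Set.Ioc (0 : ℝ) 1)) := by
    intro ρ _
    have hanti : Antitone fun t ↦ ρ.real {a | t ≤ g a} := fun s t hst ↦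
      measureReal_mono fun a (ha : t ≤ g a) ↦ hst.trans ha
    exact Integrable.of_mem_Icc 0 1 hanti.measurable.aemeasurable
      (ae_of_all _ fun t ↦ ⟨measureReal_nonneg, measureReal_le_one⟩)
  rw [hlayer μ, hlayer ν, ← integral_sub (hint μ) (hint ν)]
  have h := norm_setIntegral_le_of_norm_le_const (μ := volume) (s := Set.Ioc (0 : ℝ) 1)
    (f := fun t ↦ μ.real {a | t ≤ g a} - ν.real {a | t ≤ g a}) (C := TV μ ν) (by simp)
    fun t _ ↦ abs_measureReal_sub_le_TV μ ν (measurableSet_le measurable_const hg)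
  simpa using h

/-- Whether a point of `X × Y` belongs to a measurable set depends on its second coordinate only
up to a measurable reflexive relation, even if the diagonal of `Y × Y` is not measurable. -/
theorem MeasurableSet.exists_measurable_reflexive_relation {X Y : Type*} [MeasurableSpace X]
    [MeasurableSpace Y] {E : Set (X × Y)} (hE : MeasurableSet E) :
    ∃ R : Set (Y × Y), MeasurableSet R ∧ (∀ y, (y, y) ∈ R) ∧
      ∀ y₁ y₂, (y₁, y₂) ∈ R → ∀ x, (x, y₁) ∈ E ↔ (x, y₂) ∈ E := by
  induction E, hE using MeasurableSpace.induction_on_inter generateFrom_prod.symm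
    isPiSystem_prod with
  | empty => exact ⟨Set.univ, .univ, by simp, by simp⟩
  | basic t ht =>
    obtain ⟨A, -, B, hB, rfl⟩ := ht
    have hB : MeasurableSet B := hB
    refine ⟨{p | p.1 ∈ B ↔ p.2 ∈ B}, ?_, by simp, ?_⟩
    · exact Measurable.iff (measurable_mem.2 hB |>.comp measurable_fst)
        (measurable_mem.2 hB |>.comp measurable_snd) |>.setOf
    · intro y₁ y₂ h x
      simp only [Set.mem_prod]
      exact and_congr_right fun _ ↦ h
  | compl t _ ih =>
    obtain ⟨R, hR, hrefl, h⟩ := ih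
    exact ⟨R, hR, hrefl, fun y₁ y₂ hy x ↦ not_congr (h y₁ y₂ hy x)⟩
  | iUnion f _ _ ih =>
    choose R hR hrefl h using ih
    refine ⟨⋂ i, R i, .iInter hR, fun y ↦ Set.mem_iInter.2 fun i ↦ hrefl i y, ?_⟩
    intro y₁ y₂ hy x
    simp only [Set.mem_iUnion]
    exact exists_congr fun i ↦ h i y₁ y₂ (Set.mem_iInter.1 hy i) x

/-- A measurable function on `X × Y` depends on its second coordinate only up to a measurable
reflexive relation. -/
theorem Measurable.exists_measurable_reflexive_relation {X Y : Type*} [MeasurableSpace X]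
    [MeasurableSpace Y] {h : X × Y → ℝ} (hh : Measurable h) :
    ∃ R : Set (Y × Y), MeasurableSet R ∧ (∀ y, (y, y) ∈ R) ∧
      ∀ y₁ y₂, (y₁, y₂) ∈ R → ∀ x, h (x, y₁) = h (x, y₂) := by
  choose R hR hrefl hiff using fun q : ℚ ↦
    (measurableSet_lt hh (measurable_const (a := (q : ℝ)))).exists_measurable_reflexive_relation
  refine ⟨⋂ q, R q, .iInter hR, fun y ↦ Set.mem_iInter.2 fun q ↦ hrefl q y, ?_⟩
  intro y₁ y₂ hy x
  have key : ∀ q : ℚ, h (x, y₁) < q ↔ h (x, y₂) < q := fun q ↦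
    hiff q y₁ y₂ (Set.mem_iInter.1 hy q) x
  refine le_antisymm (le_of_not_gt fun hlt ↦ ?_) (le_of_not_gt fun hlt ↦ ?_)
  · obtain ⟨q, hq₁, hq₂⟩ := exists_rat_btwn hlt
    exact hq₂.not_gt ((key q).2 hq₁)
  · obtain ⟨q, hq₁, hq₂⟩ := exists_rat_btwn hlt
    exact hq₂.not_gt ((key q).1 hq₁)

theorem certified_distributional_robustness
    {X Y : Type*} [MeasurableSpace X] [MeasurableSpace Y]
    (dX : X × X → ℝ≥0∞) (hdX : Measurable dX)
    (d : (X × Y) × (X × Y) → ℝ≥0∞)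
    (hd : ∀ τ₁ τ₂ : X × Y,
      d (τ₁, τ₂) = if τ₁.2 = τ₂.2 then dX (τ₁.1, τ₂.1) else ⊤)
    (S : Kernel X X) [IsMarkovKernel S]
    (h : X × Y → ℝ) (hmeas : Measurable h)
    (hrange : ∀ p, h p ∈ Set.Icc (0 : ℝ) 1)
    (hbar : X × Y → ℝ)
    (hhbar : ∀ x y, hbar (x, y) = ∫ x', h (x', y) ∂(S x))
    (ψ : ℝ≥0∞ → ℝ)
    (hψ_mono : Monotone ψ)
    (hψ_conc : ConcaveOn ℝ≥0 (Set.univ : Set ℝ≥0∞) ψ)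
    (hψ_range : ∀ t, ψ t ∈ Set.Icc (0 : ℝ) 1)
    (hTV : ∀ x₁ x₂ : X, TV (S x₁) (S x₂) ≤ ψ (dX (x₁, x₂)))
    (D Dt : Measure (X × Y)) [IsProbabilityMeasure D] [IsProbabilityMeasure Dt]
    (γ : Measure ((X × Y) × (X × Y))) [IsProbabilityMeasure γ]
    (hγ₁ : γ.map Prod.fst = D) (hγ₂ : γ.map Prod.snd = Dt)
    (ε : ℝ≥0∞) (hε : ε ≠ ⊤)
    (hW : ∫⁻ p, d p ∂γ ≤ ε) :
    |(∫ p, hbar p ∂D) - ∫ p, hbar p ∂Dt| ≤ ψ ε := by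
  have hslice : ∀ y, Measurable fun x' ↦ h (x', y) := fun y ↦
    hmeas.comp measurable_prodMk_right
  have hbar_meas : Measurable hbar := by
    have h1 : StronglyMeasurable fun q : (X × Y) × X ↦ h (q.2, q.1.2) :=
      (hmeas.comp (measurable_snd.prodMk measurable_fst.snd)).stronglyMeasurable
    have h2 := (h1.integral_kernel_prod_right' (κ := S.prodMkRight Y)).measurable
    have h3 : hbar = fun p ↦ ∫ x', h (x', p.2) ∂(S.prodMkRight Y p) := by
      ext ⟨x, y⟩
      simp [hhbar]
    rwa [h3]
  have hbar_range : ∀ p, hbar p ∈ Set.Icc (0 : ℝ) 1 := by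
    rintro ⟨x, y⟩
    rw [hhbar]
    refine ⟨integral_nonneg fun x' ↦ (hrange _).1, ?_⟩
    have h1 : ∫ x', h (x', y) ∂(S x) ≤ ∫ _, (1 : ℝ) ∂(S x) :=
      integral_mono (Integrable.of_mem_Icc 0 1 (hslice y).aemeasurable
        (ae_of_all _ fun _ ↦ hrange _)) (integrable_const _) fun _ ↦ (hrange _).2
    simpa using h1
  have hint₁ : Integrable (fun p : (X × Y) × (X × Y) ↦ hbar p.1) γ :=
    Integrable.of_mem_Icc 0 1 (hbar_meas.comp measurable_fst).aemeasurable
      (ae_of_all _ fun _ ↦ hbar_range _)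
  have hint₂ : Integrable (fun p : (X × Y) × (X × Y) ↦ hbar p.2) γ :=
    Integrable.of_mem_Icc 0 1 (hbar_meas.comp measurable_snd).aemeasurable
      (ae_of_all _ fun _ ↦ hbar_range _)
  set f : (X × Y) × (X × Y) → ℝ≥0∞ := fun p ↦ dX (p.1.1, p.2.1) with hf_def
  have hf : Measurable f := hdX.comp (measurable_fst.fst.prodMk measurable_snd.fst)
  have hψf : Integrable (fun p ↦ ψ (f p)) γ :=
    Integrable.of_mem_Icc 0 1 (hψ_mono.measurable.comp hf).aemeasurable
      (ae_of_all _ fun _ ↦ hψ_range _)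
  have hfd : ∀ p, f p ≤ d p := by
    rintro ⟨τ₁, τ₂⟩
    rw [hd]
    split_ifs
    · exact le_rfl
    · exact le_top
  obtain ⟨R, hR, hrefl, hRh⟩ := hmeas.exists_measurable_reflexive_relation
  have hR' : MeasurableSet {p : (X × Y) × (X × Y) | (p.1.2, p.2.2) ∈ R} :=
    (measurable_fst.snd.prodMk measurable_snd.snd) hR
  have hmem : ∀ᵐ p ∂γ, (p.1.2, p.2.2) ∈ R := by
    have hle : ∫⁻ p, {p : (X × Y) × (X × Y) | (p.1.2, p.2.2) ∈ R}ᶜ.indicator (fun _ ↦ ⊤) p ∂γ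
        ≤ ∫⁻ p, d p ∂γ := by
      refine lintegral_mono fun p ↦ Set.indicator_apply_le' (fun hp ↦ ?_) fun _ ↦ zero_le
      obtain ⟨τ₁, τ₂⟩ := p
      have hne : τ₁.2 ≠ τ₂.2 := fun heq ↦ hp (by
        simp only [Set.mem_ofPred_eq, heq]
        exact hrefl _)
      rw [hd, if_neg hne]
    rw [lintegral_indicator_const hR'.compl] at hle
    by_contra hne
    have hpos : γ {p : (X × Y) × (X × Y) | (p.1.2, p.2.2) ∈ R}ᶜ ≠ 0 := hne
    rw [ENNReal.top_mul hpos] at hle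
    exact hε (top_le_iff.1 (hle.trans hW))
  have hpt : ∀ᵐ p ∂γ, |hbar p.1 - hbar p.2| ≤ ψ (f p) := by
    filter_upwards [hmem] with p hp
    obtain ⟨⟨x₁, y₁⟩, ⟨x₂, y₂⟩⟩ := p
    have heq : (fun x' ↦ h (x', y₁)) = fun x' ↦ h (x', y₂) := funext (hRh y₁ y₂ hp)
    simp only [hhbar, heq]
    exact (abs_integral_sub_integral_le_TV _ _ (hslice y₂) fun _ ↦ hrange _).trans (hTV x₁ x₂)
  rw [← hγ₁, ← hγ₂, integral_map measurable_fst.aemeasurable hbar_meas.aestronglyMeasurable,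
    integral_map measurable_snd.aemeasurable hbar_meas.aestronglyMeasurable,
    ← integral_sub hint₁ hint₂]
  calc |∫ p, (hbar p.1 - hbar p.2) ∂γ| ≤ ∫ p, |hbar p.1 - hbar p.2| ∂γ :=
        abs_integral_le_integral_abs
    _ ≤ ∫ p, ψ (f p) ∂γ := integral_mono_ae (hint₁.sub hint₂).abs hψf hpt
    _ ≤ ψ ε := integral_comp_le_of_concaveOn_of_lintegral_le hf hψ_mono hψ_conc hψf hε
        ((lintegral_mono hfd).trans hW)
end

section
/- Let X and Y be measurable spaces, d_X : X × X → [0, ∞] measurable, and define d((x₁,y₁),(x₂,y₂)) = d_X(x₁,x₂) if y₁ = y₂ and ∞ otherwise. Let S be a Markov kernel from X to probability measures on X, h : X × Y → [0,1] measurable, h̄(x,y) = ∫ h(x',y) dS(x)(x'), and let ψ : [0,∞] → [0,1] be concave and nondecreasing with TV(S(x₁), S(x₂)) ≤ ψ(d_X(x₁,x₂)) for all x₁, x₂. If D and D̃ are probability measures on X × Y admitting a coupling γ with ∫ d dγ ≤ ε < ∞, then ∫ h̄ dD̃ ≥ ∫ h̄ dD − ψ(ε). -/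
open MeasureTheory ProbabilityTheory
open scoped Classical ENNReal NNReal

/-- The integrals of a `[0, 1]`-valued function against two probability measures differ by at most
the total variation distance. -/
lemma integral_sub_integral_le_TV {α : Type*} [MeasurableSpace α] (μ ν : Measure α)
    [IsProbabilityMeasure μ] [IsProbabilityMeasure ν] {f : α → ℝ} (hf : Measurable f)
    (hf01 : ∀ x, f x ∈ Set.Icc (0 : ℝ) 1) :
    ∫ x, f x ∂μ - ∫ x, f x ∂ν ≤ TV μ ν := by
  have hint (ρ : Measure α) [IsProbabilityMeasure ρ] : Integrable f ρ :=
    Integrable.of_mem_Icc 0 1 hf.aemeasurable (.of_forall hf01)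
  have hcake (ρ : Measure α) [IsProbabilityMeasure ρ] :
      ∫ x, f x ∂ρ = ∫ t in Set.Ioc (0 : ℝ) 1, ρ.real {x | t ≤ f x} :=
    (hint ρ).integral_eq_integral_Ioc_meas_le (.of_forall fun x ↦ (hf01 x).1)
      (.of_forall fun x ↦ (hf01 x).2)
  have hcakeInt (ρ : Measure α) [IsProbabilityMeasure ρ] :
      IntegrableOn (fun t : ℝ ↦ ρ.real {x | t ≤ f x}) (Set.Ioc 0 1) := by
    have hanti : Antitone fun t : ℝ ↦ ρ.real {x | t ≤ f x} := fun s t hst ↦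
      measureReal_mono fun x (hx : t ≤ f x) ↦ hst.trans hx
    exact Integrable.of_mem_Icc 0 1 hanti.measurable.aemeasurable
      (.of_forall fun t ↦ ⟨measureReal_nonneg, measureReal_le_one⟩)
  have hbdd : BddAbove (Set.range fun A : {A : Set α // MeasurableSet A} ↦
      |(μ A.1).toReal - (ν A.1).toReal|) := by
    refine ⟨1, ?_⟩
    rintro _ ⟨A, rfl⟩
    have h₁ : (μ A.1).toReal ≤ 1 := measureReal_le_one
    have h₂ : (ν A.1).toReal ≤ 1 := measureReal_le_one
    have h₃ : 0 ≤ (μ A.1).toReal := ENNReal.toReal_nonneg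
    have h₄ : 0 ≤ (ν A.1).toReal := ENNReal.toReal_nonneg
    exact abs_le.2 ⟨by linarith, by linarith⟩
  rw [hcake μ, hcake ν, ← integral_sub (hcakeInt μ) (hcakeInt ν)]
  calc ∫ t in Set.Ioc (0 : ℝ) 1, (μ.real {x | t ≤ f x} - ν.real {x | t ≤ f x})
      ≤ ∫ _ in Set.Ioc (0 : ℝ) 1, TV μ ν := by
        refine integral_mono ((hcakeInt μ).sub (hcakeInt ν)) (integrable_const _) fun t ↦ ?_
        exact (le_abs_self _).trans
          (le_ciSup hbdd ⟨{x | t ≤ f x}, measurableSet_le measurable_const hf⟩)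
    _ = TV μ ν := by simp

/-- A monotone concave function on `[0, ∞]` has an affine majorant of nonnegative slope touching it
at any given point of `(0, ∞)`. -/
lemma ConcaveOn.exists_nonneg_slope_of_monotone {ψ : ℝ≥0∞ → ℝ}
    (hconc : ConcaveOn ℝ≥0 Set.univ ψ) (hmono : Monotone ψ) {e : ℝ≥0∞} (he0 : e ≠ 0)
    (he : e ≠ ⊤) :
    ∃ a : ℝ, 0 ≤ a ∧ ∀ t ≠ ⊤, ψ t ≤ ψ e + a * (t.toReal - e.toReal) := by
  set φ : ℝ → ℝ := fun t ↦ ψ (ENNReal.ofReal t) with hφ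
  have hφc : ConcaveOn ℝ (Set.Ici 0) φ := by
    refine ⟨convex_Ici 0, fun x hx y hy a b ha hb hab ↦ ?_⟩
    have key := hconc.2 (Set.mem_univ (ENNReal.ofReal x)) (Set.mem_univ (ENNReal.ofReal y))
      (zero_le (a := a.toNNReal)) (zero_le (a := b.toNNReal))
      (by rw [← Real.toNNReal_add ha hb, hab, Real.toNNReal_one])
    have hcomb : ENNReal.ofReal (a • x + b • y)
        = a.toNNReal • ENNReal.ofReal x + b.toNNReal • ENNReal.ofReal y := by
      rw [smul_eq_mul, smul_eq_mul, ENNReal.ofReal_add (mul_nonneg ha hx) (mul_nonneg hb hy),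
        ENNReal.ofReal_mul ha, ENNReal.ofReal_mul hb]
      rfl
    simp only [hφ]
    rw [hcomb]
    simpa [NNReal.smul_def, ha, hb] using key
  have hφm : Monotone φ := fun s t hst ↦ hmono (ENNReal.ofReal_le_ofReal hst)
  set r := e.toReal with hr
  have hr0 : 0 < r := ENNReal.toReal_pos he0 he
  have hφr : φ r = ψ e := by simp [hφ, hr, he]
  let A : Set ℝ := (fun z ↦ (φ z - φ r) / (z - r)) '' Set.Ioi r
  have hAle : ∀ s, 0 ≤ s → s < r → ∀ c ∈ A, c ≤ (φ r - φ s) / (r - s) := by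
    rintro s hs hsr _ ⟨z, hz, rfl⟩
    exact hφc.slope_anti_adjacent hs (Set.mem_Ici.2 (hr0.le.trans (le_of_lt hz))) hsr hz
  have hAbdd : BddAbove A := ⟨_, hAle 0 le_rfl hr0⟩
  have hAne : A.Nonempty := ⟨_, r + 1, by simp, rfl⟩
  refine ⟨sSup A, ?_, fun t ht ↦ ?_⟩
  · refine le_csSup_of_le hAbdd ⟨r + 1, by simp, rfl⟩ ?_
    have := hφm (show r ≤ r + 1 by linarith)
    exact div_nonneg (by linarith) (by linarith)
  · have hφt : φ t.toReal = ψ t := by simp [hφ, ht]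
    rw [← hφt, ← hφr]
    rcases lt_trichotomy t.toReal r with hlt | heq | hgt
    · have := csSup_le hAne (hAle _ ENNReal.toReal_nonneg hlt)
      rw [le_div_iff₀ (by linarith)] at this
      linarith
    · simp [heq]
    · have := le_csSup hAbdd ⟨t.toReal, hgt, rfl⟩
      rw [div_le_iff₀ (by linarith)] at this
      linarith

/-- Jensen's inequality for a bounded, monotone, concave function on `[0, ∞]`. No continuity at the
endpoints is needed. -/
lemma ConcaveOn.integral_comp_le_of_lintegral_le {Ω : Type*} [MeasurableSpace Ω] {μ : Measure Ω}
    [IsProbabilityMeasure μ] {ψ : ℝ≥0∞ → ℝ} (hconc : ConcaveOn ℝ≥0 Set.univ ψ)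
    (hmono : Monotone ψ) {g : Ω → ℝ≥0∞} (hg : Measurable g)
    (hint : Integrable (fun ω ↦ ψ (g ω)) μ) {e : ℝ≥0∞} (he : e ≠ ⊤) (hge : ∫⁻ ω, g ω ∂μ ≤ e) :
    ∫ ω, ψ (g ω) ∂μ ≤ ψ e := by
  rcases eq_or_ne e 0 with rfl | he0
  · have hzero : g =ᵐ[μ] 0 := (lintegral_eq_zero_iff hg).1 (le_antisymm hge zero_le)
    have : ∫ ω, ψ (g ω) ∂μ = ∫ _, ψ 0 ∂μ :=
      integral_congr_ae (hzero.mono fun ω hω ↦ by simp [hω])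
    simp [this]
  obtain ⟨a, ha, hle⟩ := hconc.exists_nonneg_slope_of_monotone hmono he0 he
  have hne : ∫⁻ ω, g ω ∂μ ≠ ⊤ := ne_top_of_le_ne_top he hge
  have hfin : ∀ᵐ ω ∂μ, g ω < ⊤ := ae_lt_top hg hne
  have hgint : Integrable (fun ω ↦ (g ω).toReal) μ :=
    integrable_toReal_of_lintegral_ne_top hg.aemeasurable hne
  have hgmean : ∫ ω, (g ω).toReal ∂μ ≤ e.toReal := by
    rw [integral_toReal hg.aemeasurable hfin]
    exact ENNReal.toReal_mono he hge
  have hsub : Integrable (fun ω ↦ a * ((g ω).toReal - e.toReal)) μ :=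
    (hgint.sub (integrable_const _)).const_mul a
  calc ∫ ω, ψ (g ω) ∂μ ≤ ∫ ω, (ψ e + a * ((g ω).toReal - e.toReal)) ∂μ :=
        integral_mono_ae hint ((integrable_const _).add hsub) (hfin.mono fun ω hω ↦ hle _ hω.ne)
    _ = ψ e + a * (∫ ω, (g ω).toReal ∂μ - e.toReal) := by
        rw [integral_add (integrable_const _) hsub, integral_const_mul,
          integral_sub hgint (integrable_const _)]
        simp
    _ ≤ ψ e := by nlinarith

theorem certified_accuracy_lower_bound
    {X Y : Type*} [MeasurableSpace X] [MeasurableSpace Y]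
    (dX : X × X → ℝ≥0∞) (hdX : Measurable dX)
    (d : (X × Y) × (X × Y) → ℝ≥0∞)
    (hd : ∀ τ₁ τ₂ : X × Y,
      d (τ₁, τ₂) = if τ₁.2 = τ₂.2 then dX (τ₁.1, τ₂.1) else ⊤)
    (S : Kernel X X) [IsMarkovKernel S]
    (h : X × Y → ℝ) (hmeas : Measurable h)
    (hrange : ∀ p, h p ∈ Set.Icc (0 : ℝ) 1)
    (hbar : X × Y → ℝ)
    (hhbar : ∀ x y, hbar (x, y) = ∫ x', h (x', y) ∂(S x))
    (ψ : ℝ≥0∞ → ℝ)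
    (hψ_mono : Monotone ψ)
    (hψ_conc : ConcaveOn ℝ≥0 (Set.univ : Set ℝ≥0∞) ψ)
    (hψ_range : ∀ t, ψ t ∈ Set.Icc (0 : ℝ) 1)
    (hTV : ∀ x₁ x₂ : X, TV (S x₁) (S x₂) ≤ ψ (dX (x₁, x₂)))
    (D Dt : Measure (X × Y)) [IsProbabilityMeasure D] [IsProbabilityMeasure Dt]
    (γ : Measure ((X × Y) × (X × Y))) [IsProbabilityMeasure γ]
    (hγ₁ : γ.map Prod.fst = D) (hγ₂ : γ.map Prod.snd = Dt)
    (ε : ℝ≥0∞) (hε : ε ≠ ⊤)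
    (hW : ∫⁻ p, d p ∂γ ≤ ε) :
    (∫ p, hbar p ∂Dt) ≥ (∫ p, hbar p ∂D) - ψ ε := by
  have hbar_meas : Measurable hbar := by
    have hsm : StronglyMeasurable fun p : X × Y ↦
        ∫ x', (fun q : (X × Y) × X ↦ h (q.2, q.1.2)) (p, x')
          ∂(S.comap Prod.fst measurable_fst p) :=
      StronglyMeasurable.integral_kernel_prod_right'
        (hmeas.comp (by fun_prop : Measurable fun q : (X × Y) × X ↦
          (q.2, q.1.2))).stronglyMeasurable
    convert hsm.measurable using 1
    funext p
    simp [← hhbar]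
  have hbar_mem : ∀ p, hbar p ∈ Set.Icc (0 : ℝ) 1 := fun p ↦ by
    rw [← Prod.mk.eta (p := p), hhbar]
    refine ⟨integral_nonneg fun _ ↦ (hrange _).1, ?_⟩
    calc ∫ x', h (x', p.2) ∂(S p.1) ≤ ∫ _, (1 : ℝ) ∂(S p.1) :=
          integral_mono_of_nonneg (.of_forall fun _ ↦ (hrange _).1) (integrable_const _)
            (.of_forall fun _ ↦ (hrange _).2)
      _ = 1 := by simp
  have hsame : ∀ x₁ x₂ y, hbar (x₁, y) - hbar (x₂, y) ≤ ψ (dX (x₁, x₂)) := fun x₁ x₂ y ↦ by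
    rw [hhbar, hhbar]
    exact (integral_sub_integral_le_TV (S x₁) (S x₂) (f := fun x' ↦ h (x', y))
      (hmeas.comp measurable_prodMk_right) fun _ ↦ hrange _).trans (hTV x₁ x₂)
  let g : (X × Y) × (X × Y) → ℝ≥0∞ := fun p ↦ dX (p.1.1, p.2.1)
  have hg : Measurable g := hdX.comp (by fun_prop)
  have hψg : Measurable fun p ↦ ψ (g p) := hψ_mono.measurable.comp hg
  have hgd : ∀ p, g p ≤ d p := fun p ↦ by
    rw [← Prod.mk.eta (p := p), hd]
    split_ifs
    · exact le_rfl
    · exact le_top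
  have hg_lint : ∫⁻ p, g p ∂γ ≤ ε := (lintegral_mono hgd).trans hW
  -- The diagonal of `Y` need not be measurable, so the infinite-cost event is replaced by the
  -- measurable event on which the desired pointwise bound fails.
  let E : Set ((X × Y) × (X × Y)) := {p | ψ (g p) < hbar p.1 - hbar p.2}
  have hE : MeasurableSet E := measurableSet_lt hψg
    ((hbar_meas.comp measurable_fst).sub (hbar_meas.comp measurable_snd))
  have hEd : ∀ p ∈ E, d p = ⊤ := by
    rintro ⟨⟨x₁, y₁⟩, ⟨x₂, y₂⟩⟩ hp
    rw [hd, if_neg]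
    rintro (rfl : y₁ = y₂)
    exact absurd (hsame x₁ x₂ y₁) (not_le.2 hp)
  have hE0 : γ E = 0 := by
    by_contra hne
    refine (ne_top_of_le_ne_top hε hW) (top_le_iff.1 ?_)
    calc (⊤ : ℝ≥0∞) = ∫⁻ p, E.indicator (fun _ ↦ ⊤) p ∂γ := by
          rw [lintegral_indicator_const hE, ENNReal.top_mul hne]
      _ ≤ ∫⁻ p, d p ∂γ := lintegral_mono fun p ↦
          Set.indicator_le (fun q hq ↦ (hEd q hq).ge) p
  have hae : ∀ᵐ p ∂γ, hbar p.1 - hbar p.2 ≤ ψ (g p) := by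
    filter_upwards [measure_eq_zero_iff_ae_notMem.1 hE0] with p hp using not_lt.1 hp
  have hψint : Integrable (fun p ↦ ψ (g p)) γ :=
    Integrable.of_mem_Icc 0 1 hψg.aemeasurable (.of_forall fun _ ↦ hψ_range _)
  have hint₁ : Integrable (fun p ↦ hbar p.1) γ :=
    Integrable.of_mem_Icc 0 1 (hbar_meas.comp measurable_fst).aemeasurable
      (.of_forall fun _ ↦ hbar_mem _)
  have hint₂ : Integrable (fun p ↦ hbar p.2) γ :=
    Integrable.of_mem_Icc 0 1 (hbar_meas.comp measurable_snd).aemeasurable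
      (.of_forall fun _ ↦ hbar_mem _)
  have hD : ∫ p, hbar p ∂D = ∫ p, hbar p.1 ∂γ := by
    rw [← hγ₁]
    exact integral_map measurable_fst.aemeasurable hbar_meas.aestronglyMeasurable
  have hDt : ∫ p, hbar p ∂Dt = ∫ p, hbar p.2 ∂γ := by
    rw [← hγ₂]
    exact integral_map measurable_snd.aemeasurable hbar_meas.aestronglyMeasurable
  have hdiff : ∫ p, hbar p.1 ∂γ - ∫ p, hbar p.2 ∂γ ≤ ψ ε := by
    rw [← integral_sub hint₁ hint₂]
    exact (integral_mono_ae (hint₁.sub hint₂) hψint hae).trans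
      (hψ_conc.integral_comp_le_of_lintegral_le hψ_mono hg hψint hε hg_lint)
  rw [hD, hDt]
  linarith
end

section
/- Let X be a measurable space and P = ℝᵏ with a norm ‖·‖. Let T : X × P → X be a function such that T(x,0) = x for all x, T(·,θ) is jointly such that θ ↦ T(x,θ) is measurable for each x, and T satisfies additive composability: T(T(x,θ₁),θ₂) = T(x, θ₁ + θ₂) for all x ∈ X and θ₁, θ₂ ∈ P. Let Q be a probability measure on P and ψ : [0,∞) → [0,1] a function such that for every θ ∈ P, TV(Q, (·+θ)_*Q) ≤ ψ(‖θ‖), where (·+θ)_*Q denotes the pushforward of Q under translation by θ. Define the smoothing distribution S(x) = (T(x,·))_*Q, the pushforward of Q under θ ↦ T(x,θ). Then for any x₁, x₂ ∈ X and any θ ∈ P with T(x₁,θ) = x₂, TV(S(x₁), S(x₂)) ≤ ψ(‖θ‖). -/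
open MeasureTheory

/-- The total variation distance of finite measures bounds the discrepancy on each measurable set. -/
theorem abs_toReal_sub_toReal_le_TV {α : Type*} [MeasurableSpace α] (μ ν : Measure α)
    [IsFiniteMeasure μ] [IsFiniteMeasure ν] {A : Set α} (hA : MeasurableSet A) :
    |(μ A).toReal - (ν A).toReal| ≤ TV μ ν := by
  refine le_ciSup (f := fun A : {A : Set α // MeasurableSet A} =>
    |(μ A.1).toReal - (ν A.1).toReal|) ⟨(μ Set.univ).toReal + (ν Set.univ).toReal, ?_⟩ ⟨A, hA⟩
  rintro _ ⟨B, rfl⟩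
  have hμ : (μ B.1).toReal ≤ (μ Set.univ).toReal :=
    ENNReal.toReal_mono (measure_ne_top _ _) (measure_mono (Set.subset_univ _))
  have hν : (ν B.1).toReal ≤ (ν Set.univ).toReal :=
    ENNReal.toReal_mono (measure_ne_top _ _) (measure_mono (Set.subset_univ _))
  have hμ0 : 0 ≤ (μ B.1).toReal := ENNReal.toReal_nonneg
  have hν0 : 0 ≤ (ν B.1).toReal := ENNReal.toReal_nonneg
  exact abs_le.mpr ⟨by linarith, by linarith⟩

/-- Pushing forward along a measurable map does not increase the total variation distance. -/
theorem TV_map_le {α β : Type*} [MeasurableSpace α] [MeasurableSpace β] (μ ν : Measure α)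
    [IsFiniteMeasure μ] [IsFiniteMeasure ν] {f : α → β} (hf : Measurable f) :
    TV (μ.map f) (ν.map f) ≤ TV μ ν := by
  have : Nonempty {A : Set β // MeasurableSet A} := ⟨⟨∅, MeasurableSet.empty⟩⟩
  refine ciSup_le fun A => ?_
  rw [Measure.map_apply hf A.2, Measure.map_apply hf A.2]
  exact abs_toReal_sub_toReal_le_TV μ ν (hf A.2)

theorem tv_bound_for_parameterized_smoothing
    {X : Type*} [MeasurableSpace X] {k : ℕ}
    (T : X × (Fin k → ℝ) → X)
    (hT0 : ∀ x, T (x, 0) = x)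
    (hTmeas : ∀ x : X, Measurable fun θ => T (x, θ))
    (hTadd : ∀ (x : X) (θ₁ θ₂ : Fin k → ℝ), T (T (x, θ₁), θ₂) = T (x, θ₁ + θ₂))
    (Q : Measure (Fin k → ℝ)) [IsProbabilityMeasure Q]
    (ψ : ℝ → ℝ) (hψ_range : ∀ t ≥ (0 : ℝ), ψ t ∈ Set.Icc (0 : ℝ) 1)
    (hψ : ∀ θ : Fin k → ℝ, TV Q (Q.map (· + θ)) ≤ ψ ‖θ‖)
    (x₁ x₂ : X) (θ : Fin k → ℝ) (hθ : T (x₁, θ) = x₂) :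
    TV (Q.map fun η => T (x₁, η)) (Q.map fun η => T (x₂, η)) ≤ ψ ‖θ‖ := by
  have hmap : (Q.map fun η => T (x₂, η)) = (Q.map (· + θ)).map fun η => T (x₁, η) := by
    rw [Measure.map_map (hTmeas x₁) (measurable_add_const θ)]
    congr 1
    funext η
    rw [← hθ, hTadd, add_comm, Function.comp_apply]
  rw [hmap]
  exact (TV_map_le _ _ (hTmeas x₁)).trans (hψ θ)
end

section
/- Let b > 0 and θ ∈ ℝⁿ. Let U(0,b) denote the uniform probability measure on the box ∏ᵢ [0,b] ⊆ ℝⁿ (normalized Lebesgue measure restricted to the box) and U(θ,b) the uniform probability measure on ∏ᵢ [θᵢ, θᵢ + b]. Then TV(U(0,b), U(θ,b)) ≤ ‖θ‖₁ / b, where ‖θ‖₁ = Σᵢ |θᵢ|. -/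
open MeasureTheory
open scoped ENNReal

/-- The uniform probability measure on the box `∏ᵢ [θᵢ, θᵢ + b] ⊆ ℝⁿ`:
Lebesgue measure restricted to the box, divided by its volume. -/
noncomputable def uniformBox {n : ℕ} (θ : Fin n → ℝ) (b : ℝ) : Measure (Fin n → ℝ) :=
  (volume (Set.univ.pi fun i => Set.Icc (θ i) (θ i + b)))⁻¹ •
    volume.restrict (Set.univ.pi fun i => Set.Icc (θ i) (θ i + b))

theorem one_sub_sum_le_prod_max {ι : Type*} (s : Finset ι) (t : ι → ℝ) (ht : ∀ i, 0 ≤ t i) :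
    1 - ∑ i ∈ s, t i ≤ ∏ i ∈ s, max (1 - t i) 0 := by
  classical
  induction s using Finset.induction_on with
  | empty => simp
  | insert a s ha ih =>
    rw [Finset.sum_insert ha, Finset.prod_insert ha]
    have h0 : 0 ≤ ∏ i ∈ s, max (1 - t i) 0 :=
      Finset.prod_nonneg fun i _ => le_max_right _ _
    have h1 : ∏ i ∈ s, max (1 - t i) 0 ≤ 1 :=
      Finset.prod_le_one (fun i _ => le_max_right _ _)
        fun i _ => max_le (by linarith [ht i]) zero_le_one
    have h2 := mul_le_mul_of_nonneg_right (le_max_left (1 - t a) 0) h0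
    nlinarith [ht a]

theorem volume_real_pi_Icc {n : ℕ} (l u : Fin n → ℝ) :
    volume.real (Set.univ.pi fun i => Set.Icc (l i) (u i)) = ∏ i, max (u i - l i) 0 := by
  rw [Measure.real, volume_pi_pi, ENNReal.toReal_prod]
  simp [ENNReal.toReal_ofReal']

theorem volume_pi_Icc_ne_top {n : ℕ} (l u : Fin n → ℝ) :
    volume (Set.univ.pi fun i => Set.Icc (l i) (u i)) ≠ ∞ :=
  (isCompact_univ_pi fun _ => isCompact_Icc).measure_ne_top

theorem volume_real_box {n : ℕ} {b : ℝ} (hb : 0 ≤ b) (θ : Fin n → ℝ) :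
    volume.real (Set.univ.pi fun i => Set.Icc (θ i) (θ i + b)) = b ^ n := by
  rw [volume_real_pi_Icc]
  simp [hb]

theorem volume_real_box_inter {n : ℕ} {b : ℝ} (hb : 0 < b) (θ η : Fin n → ℝ) :
    volume.real ((Set.univ.pi fun i => Set.Icc (θ i) (θ i + b)) ∩
      Set.univ.pi fun i => Set.Icc (η i) (η i + b)) =
      b ^ n * ∏ i, max (1 - |θ i - η i| / b) 0 := by
  rw [← Set.pi_inter_distrib]
  simp only [Set.Icc_inter_Icc]
  rw [volume_real_pi_Icc (fun i => θ i ⊔ η i) (fun i => (θ i + b) ⊓ (η i + b))]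
  have hpow : b ^ n = ∏ _i : Fin n, b := by simp
  rw [hpow, ← Finset.prod_mul_distrib]
  refine Finset.prod_congr rfl fun i _ => ?_
  rw [mul_max_of_nonneg _ _ hb.le, mul_sub, mul_div_cancel₀ _ hb.ne', mul_one, mul_zero]
  congr 1
  rcases le_total (θ i) (η i) with h | h
  · rw [sup_eq_right.2 h, inf_eq_left.2 (by linarith), abs_of_nonpos (by linarith)]
    ring
  · rw [sup_eq_left.2 h, inf_eq_right.2 (by linarith), abs_of_nonneg (by linarith)]
    ring

theorem toReal_uniformBox_apply {n : ℕ} {b : ℝ} (hb : 0 ≤ b) (θ : Fin n → ℝ)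
    {A : Set (Fin n → ℝ)} (hA : MeasurableSet A) :
    (uniformBox θ b A).toReal =
      (b ^ n)⁻¹ * volume.real (A ∩ Set.univ.pi fun i => Set.Icc (θ i) (θ i + b)) := by
  rw [uniformBox, Measure.smul_apply, Measure.restrict_apply hA, smul_eq_mul,
    ENNReal.toReal_mul, ENNReal.toReal_inv, ← volume_real_box hb θ]
  rfl

theorem toReal_uniformBox_sub_le {n : ℕ} {b : ℝ} (hb : 0 < b) (θ η : Fin n → ℝ)
    {A : Set (Fin n → ℝ)} (hA : MeasurableSet A) :
    (uniformBox θ b A).toReal - (uniformBox η b A).toReal ≤ (∑ i, |θ i - η i|) / b := by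
  rw [toReal_uniformBox_apply hb.le θ hA, toReal_uniformBox_apply hb.le η hA]
  have hinter := volume_real_box_inter hb θ η
  have hbox := volume_real_box hb.le θ
  have hfinθ := volume_pi_Icc_ne_top θ (fun i => θ i + b)
  have hfinη := volume_pi_Icc_ne_top η (fun i => η i + b)
  have hmeas : MeasurableSet (Set.univ.pi fun i => Set.Icc (η i) (η i + b)) :=
    MeasurableSet.univ_pi fun _ => measurableSet_Icc
  set S := Set.univ.pi fun i => Set.Icc (θ i) (θ i + b)
  set T := Set.univ.pi fun i => Set.Icc (η i) (η i + b)
  have hsplit : volume.real (S ∩ T) + volume.real (S \ T) = volume.real S :=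
    measureReal_inter_add_sdiff hmeas hfinθ
  have hcover : volume.real (A ∩ S) ≤ volume.real (A ∩ T) + volume.real (S \ T) := by
    refine (measureReal_mono ?_ ?_).trans (measureReal_union_le _ _)
    · rintro x ⟨hxA, hxS⟩
      by_cases hxT : x ∈ T
      · exact Or.inl ⟨hxA, hxT⟩
      · exact Or.inr ⟨hxS, hxT⟩
    · exact measure_union_ne_top (measure_ne_top_of_subset Set.inter_subset_right hfinη)
        (measure_ne_top_of_subset Set.sdiff_subset hfinθ)
  have hprod := one_sub_sum_le_prod_max Finset.univ (fun i => |θ i - η i| / b)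
    fun i => by positivity
  rw [Finset.sum_div, ← mul_sub, inv_mul_le_iff₀ (by positivity)]
  have := mul_le_mul_of_nonneg_left hprod (pow_nonneg hb.le n)
  linarith

theorem tv_uniform_box_le
    {n : ℕ} (b : ℝ) (hb : 0 < b) (θ : Fin n → ℝ) :
    TV (uniformBox 0 b) (uniformBox θ b) ≤ (∑ i, |θ i|) / b := by
  have : Nonempty {A : Set (Fin n → ℝ) // MeasurableSet A} := ⟨⟨∅, MeasurableSet.empty⟩⟩
  refine ciSup_le fun A => abs_sub_le_iff.2 ⟨?_, ?_⟩
  · simpa using toReal_uniformBox_sub_le hb 0 θ A.2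
  · simpa using toReal_uniformBox_sub_le hb θ 0 A.2
end

section
/- Let I be a nonempty finite index set (the pixels). An HSV image is a function x : I → ℝ³ with values x(i) = (h_i, s_i, v_i) where the saturations s_i and brightness values v_i are nonnegative and max(s_max, v_max) > 0, where s_max = max_i s_i, v_max = max_i v_i, and let s_mean and v_mean denote the averages of s_i and v_i over I. For θ = (θ_S, θ_V) ∈ ℝ≥0², define SV(x, θ) to be the image whose pixel i equals (h_i, (s_i + (2^{θ_S} − 1) s_mean)/MAX, (v_i + (2^{θ_V} − 1) v_mean)/MAX), where MAX = max(s_max + (2^{θ_S} − 1) s_mean, v_max + (2^{θ_V} − 1) v_mean). Then for all such x and all θ₁, θ₂ ∈ ℝ≥0², SV(SV(x, θ₁), θ₂) = SV(x, θ₁ + θ₂). -/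
/-- Mean of a real-valued function over a nonempty finite pixel set. -/
noncomputable def pixMean {I : Type*} [Fintype I] (f : I → ℝ) : ℝ :=
  (∑ i, f i) / (Fintype.card I : ℝ)

/-- Maximum of a real-valued function over a nonempty finite pixel set. -/
noncomputable def pixMax {I : Type*} [Fintype I] [Nonempty I] (f : I → ℝ) : ℝ :=
  Finset.univ.sup' Finset.univ_nonempty f

/-- The SV (saturation/brightness) shift of an HSV image `x : I → ℝ × ℝ × ℝ`
(each pixel being a triple (hue, saturation, value)) by parameters
`θ = (θ_S, θ_V)`: shift each saturation by `(2^{θ_S} - 1) s_mean` and each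
brightness by `(2^{θ_V} - 1) v_mean`, leaving hues unchanged, then divide the
saturation and brightness values by the maximum of the shifted saturation
maximum and the shifted brightness maximum. -/
noncomputable def SV {I : Type*} [Fintype I] [Nonempty I]
    (x : I → ℝ × ℝ × ℝ) (θ : ℝ × ℝ) : I → ℝ × ℝ × ℝ :=
  fun i =>
    let s : I → ℝ := fun j => (x j).2.1
    let v : I → ℝ := fun j => (x j).2.2
    let MAX : ℝ := max (pixMax s + ((2 : ℝ) ^ θ.1 - 1) * pixMean s)
                       (pixMax v + ((2 : ℝ) ^ θ.2 - 1) * pixMean v)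
    ((x i).1,
     ((x i).2.1 + ((2 : ℝ) ^ θ.1 - 1) * pixMean s) / MAX,
     ((x i).2.2 + ((2 : ℝ) ^ θ.2 - 1) * pixMean v) / MAX)

theorem pixMean_shift_div {I : Type*} [Fintype I] [Nonempty I] (f : I → ℝ) (c M : ℝ) :
    pixMean (fun i => (f i + c) / M) = (pixMean f + c) / M := by
  have hcard : (Fintype.card I : ℝ) ≠ 0 := Nat.cast_ne_zero.mpr Fintype.card_ne_zero
  simp only [pixMean, ← Finset.sum_div, Finset.sum_add_distrib, Finset.sum_const,
    Finset.card_univ, nsmul_eq_mul]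
  rw [div_right_comm, add_div, mul_div_cancel_left₀ _ hcard]

theorem pixMax_shift_div {I : Type*} [Fintype I] [Nonempty I] (f : I → ℝ) (c : ℝ) {M : ℝ}
    (hM : 0 ≤ M) : pixMax (fun i => (f i + c) / M) = (pixMax f + c) / M := by
  have hmono : Monotone fun t : ℝ => (t + c) / M := fun a b hab => by
    dsimp only
    gcongr
  exact (Finset.apply_sup'_eq_sup'_comp Finset.univ_nonempty (fun t : ℝ => (t + c) / M)
    fun _ _ => hmono.map_sup _ _).symm

theorem pixMean_nonneg {I : Type*} [Fintype I] {f : I → ℝ} (hf : ∀ i, 0 ≤ f i) :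
    0 ≤ pixMean f :=
  div_nonneg (Finset.sum_nonneg fun i _ => hf i) (Nat.cast_nonneg _)

theorem two_rpow_sub_one_mul_pixMean_nonneg {I : Type*} [Fintype I] {f : I → ℝ}
    (hf : ∀ i, 0 ≤ f i) {t : ℝ} (ht : 0 ≤ t) : 0 ≤ ((2 : ℝ) ^ t - 1) * pixMean f :=
  mul_nonneg (sub_nonneg.mpr (Real.one_le_rpow one_le_two ht)) (pixMean_nonneg hf)

theorem shift_div_shift (a b m z M : ℝ) :
    (z + ((2 : ℝ) ^ a - 1) * m) / M + ((2 : ℝ) ^ b - 1) * ((m + ((2 : ℝ) ^ a - 1) * m) / M) =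
      (z + ((2 : ℝ) ^ (a + b) - 1) * m) / M := by
  rw [Real.rpow_add two_pos]
  ring

theorem SV_additive_composability
    {I : Type*} [Fintype I] [Nonempty I]
    (x : I → ℝ × ℝ × ℝ)
    (hs : ∀ i, 0 ≤ (x i).2.1) (hv : ∀ i, 0 ≤ (x i).2.2)
    (hmax : 0 < max (pixMax fun j => (x j).2.1) (pixMax fun j => (x j).2.2))
    (θ₁ θ₂ : ℝ × ℝ)
    (hθ₁ : 0 ≤ θ₁.1 ∧ 0 ≤ θ₁.2) (hθ₂ : 0 ≤ θ₂.1 ∧ 0 ≤ θ₂.2) :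
    SV (SV x θ₁) θ₂ = SV x (θ₁ + θ₂) := by
  have hM : 0 < max
      (pixMax (fun j => (x j).2.1) + ((2 : ℝ) ^ θ₁.1 - 1) * pixMean (fun j => (x j).2.1))
      (pixMax (fun j => (x j).2.2) + ((2 : ℝ) ^ θ₁.2 - 1) * pixMean (fun j => (x j).2.2)) :=
    hmax.trans_le (max_le_max
      (le_add_of_nonneg_right (two_rpow_sub_one_mul_pixMean_nonneg hs hθ₁.1))
      (le_add_of_nonneg_right (two_rpow_sub_one_mul_pixMean_nonneg hv hθ₁.2)))
  funext i
  simp only [SV, Prod.fst_add, Prod.snd_add]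
  generalize max
    (pixMax (fun j => (x j).2.1) + ((2 : ℝ) ^ θ₁.1 - 1) * pixMean (fun j => (x j).2.1))
    (pixMax (fun j => (x j).2.2) + ((2 : ℝ) ^ θ₁.2 - 1) * pixMean (fun j => (x j).2.2)) = M at hM ⊢
  simp only [pixMean_shift_div, pixMax_shift_div _ _ hM.le, shift_div_shift,
    max_div_div_right hM.le, div_div_div_cancel_right₀ hM.ne']
end

section
/- Let X and Y be measurable spaces, d_X : X × X → [0, ∞] measurable with d_X(x,x) = 0 for all x, and define d((x₁,y₁),(x₂,y₂)) = d_X(x₁,x₂) if y₁ = y₂ and ∞ otherwise. Let S be a Markov kernel from X to probability measures on X such that TV(S(x₁), S(x₂)) = 0 whenever d_X(x₁,x₂) < ∞. Let h : X × Y → [0,1] be measurable and h̄(x,y) = ∫ h(x',y) dS(x)(x'). If D and D̃ are probability measures on X × Y admitting a coupling γ with ∫ d dγ ≤ ε for some finite ε ≥ 0, then ∫ h̄ dD = ∫ h̄ dD̃. -/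
open MeasureTheory ProbabilityTheory
open scoped Classical ENNReal NNReal

theorem measure_eq_of_TV_eq_zero {α : Type*} [MeasurableSpace α] (μ ν : Measure α)
    [IsProbabilityMeasure μ] [IsProbabilityMeasure ν] (hTV : TV μ ν = 0) : μ = ν := by
  have hbdd : BddAbove (Set.range fun A : {A : Set α // MeasurableSet A} =>
      |(μ A.1).toReal - (ν A.1).toReal|) := by
    refine ⟨1, ?_⟩
    rintro _ ⟨A, rfl⟩
    have h₁ : (μ A.1).toReal ≤ 1 := measureReal_le_one
    have h₂ : (ν A.1).toReal ≤ 1 := measureReal_le_one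
    have h₃ : 0 ≤ (μ A.1).toReal := ENNReal.toReal_nonneg
    have h₄ : 0 ≤ (ν A.1).toReal := ENNReal.toReal_nonneg
    exact abs_le.mpr ⟨by linarith, by linarith⟩
  refine Measure.ext fun A hA => ?_
  have hle : |(μ A).toReal - (ν A).toReal| ≤ TV μ ν := le_ciSup hbdd ⟨A, hA⟩
  rw [hTV] at hle
  have heq : (μ A).toReal = (ν A).toReal :=
    sub_eq_zero.mp (abs_eq_zero.mp (le_antisymm hle (abs_nonneg _)))
  exact (ENNReal.toReal_eq_toReal_iff' (measure_ne_top _ _) (measure_ne_top _ _)).mp heq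

/-- No measurability of `f` is needed: the lower integral detects every measurable subset
of `{f = ⊤}`. -/
theorem measure_eq_zero_of_lintegral_ne_top {α : Type*} [MeasurableSpace α] {μ : Measure α}
    {f : α → ℝ≥0∞} (hf : ∫⁻ a, f a ∂μ ≠ ⊤) {B : Set α} (hB : MeasurableSet B)
    (hfB : ∀ a ∈ B, f a = ⊤) : μ B = 0 := by
  by_contra hne
  refine hf (top_le_iff.mp ?_)
  calc ⊤ = ∫⁻ a, B.indicator (fun _ => ⊤) a ∂μ := by
        rw [lintegral_indicator_const hB, ENNReal.top_mul hne]
    _ ≤ ∫⁻ a, f a ∂μ := lintegral_mono fun a => by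
        by_cases ha : a ∈ B
        · simp [hfB a ha]
        · simp [ha]

theorem invariant_smoothing_preserves_accuracy
    {X Y : Type*} [MeasurableSpace X] [MeasurableSpace Y]
    (dX : X × X → ℝ≥0∞) (hdX : Measurable dX)
    (hdX_refl : ∀ x : X, dX (x, x) = 0)
    (d : (X × Y) × (X × Y) → ℝ≥0∞)
    (hd : ∀ τ₁ τ₂ : X × Y,
      d (τ₁, τ₂) = if τ₁.2 = τ₂.2 then dX (τ₁.1, τ₂.1) else ⊤)
    (S : Kernel X X) [IsMarkovKernel S]
    (hTV : ∀ x₁ x₂ : X, dX (x₁, x₂) < ⊤ → TV (S x₁) (S x₂) = 0)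
    (h : X × Y → ℝ) (hmeas : Measurable h)
    (hrange : ∀ p, h p ∈ Set.Icc (0 : ℝ) 1)
    (hbar : X × Y → ℝ)
    (hhbar : ∀ x y, hbar (x, y) = ∫ x', h (x', y) ∂(S x))
    (D Dt : Measure (X × Y)) [IsProbabilityMeasure D] [IsProbabilityMeasure Dt]
    (γ : Measure ((X × Y) × (X × Y))) [IsProbabilityMeasure γ]
    (hγ₁ : γ.map Prod.fst = D) (hγ₂ : γ.map Prod.snd = Dt)
    (ε : ℝ≥0∞) (hε : ε ≠ ⊤)
    (hW : ∫⁻ p, d p ∂γ ≤ ε) :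
    (∫ p, hbar p ∂D) = ∫ p, hbar p ∂Dt := by
  have hbar_meas : Measurable hbar := by
    have hsm : StronglyMeasurable fun q : (X × Y) × X => h (q.2, q.1.2) :=
      (hmeas.comp (by fun_prop)).stronglyMeasurable
    have hint := hsm.integral_kernel_prod_right' (κ := S.comap Prod.fst measurable_fst)
    have heq : hbar = fun p : X × Y =>
        ∫ x', h (x', p.2) ∂((S.comap Prod.fst measurable_fst : Kernel (X × Y) X) p) := by
      funext p
      exact hhbar p.1 p.2
    rw [heq]
    exact hint.measurable
  have hnull : γ {p | hbar p.1 ≠ hbar p.2} = 0 := by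
    refine measure_eq_zero_of_lintegral_ne_top (ne_top_of_le_ne_top hε hW)
      (measurableSet_eq_fun (hbar_meas.comp measurable_fst)
        (hbar_meas.comp measurable_snd)).compl ?_
    rintro ⟨⟨x₁, y₁⟩, ⟨x₂, y₂⟩⟩ hp
    by_contra hfin
    rw [hd] at hfin
    split_ifs at hfin with hy
    · obtain rfl : y₁ = y₂ := hy
      have hS := measure_eq_of_TV_eq_zero _ _ (hTV x₁ x₂ (lt_top_iff_ne_top.mpr hfin))
      exact hp (show hbar (x₁, y₁) = hbar (x₂, y₁) by rw [hhbar, hhbar, hS])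
    · exact hfin rfl
  rw [← hγ₁, ← hγ₂,
    integral_map measurable_fst.aemeasurable hbar_meas.aestronglyMeasurable,
    integral_map measurable_snd.aemeasurable hbar_meas.aestronglyMeasurable]
  exact integral_congr_ae (ae_iff.mpr hnull)
end

section
/- Let I be a nonempty finite index set and let u : I → ℝ be a nonnegative function with max_{i∈I} u(i) > 0. Then for every c > 0, the normalized scaled function equals the normalized original function: for all i ∈ I, (c · u(i)) / (max_{j∈I} c · u(j)) = u(i) / (max_{j∈I} u(j)). Consequently, the random-channel smoothing distribution — which selects one color channel of an RGB image uniformly at random, rescales it so that its maximum value is one, and sets the other channels to zero — is invariant under the color shift transformation CS: for any image x with positive channel maxima and any θ ∈ ℝ³, the random-channel smoothing distribution of CS(x, θ) equals that of x. -/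
open MeasureTheory
open scoped ENNReal

/-- The maximum intensity of channel `c` over all pixels of the image `x`. -/
noncomputable def chMax {I : Type*} [Fintype I] [Nonempty I]
    (x : I → Fin 3 → ℝ) (c : Fin 3) : ℝ :=
  Finset.univ.sup' Finset.univ_nonempty fun i => x i c

/-- Color shift: scale channel `c` by `2 ^ θ c` and renormalize so that the
overall maximum intensity is one. -/
noncomputable def CS {I : Type*} [Fintype I] [Nonempty I]
    (x : I → Fin 3 → ℝ) (θ : Fin 3 → ℝ) : I → Fin 3 → ℝ :=
  fun i c => ((2 : ℝ) ^ (θ c) * x i c) /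
    Finset.univ.sup' Finset.univ_nonempty
      (fun c' : Fin 3 => (2 : ℝ) ^ (θ c') * chMax x c')

/-- Keep only channel `c`, rescaled so that its maximum pixel value is one;
all other channels are set to zero. -/
noncomputable def rescaleChannel {I : Type*} [Fintype I] [Nonempty I]
    (x : I → Fin 3 → ℝ) (c : Fin 3) : I → Fin 3 → ℝ :=
  fun i c' => if c' = c then x i c / chMax x c else 0

/-- The random-channel smoothing distribution: pick one of the three channels
uniformly at random, rescale it so that its maximum value is one, and set the
other channels to zero. -/
noncomputable def randChannel {I : Type*} [Fintype I] [Nonempty I]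
    (x : I → Fin 3 → ℝ) : Measure (I → Fin 3 → ℝ) :=
  (3 : ℝ≥0∞)⁻¹ • (Measure.dirac (rescaleChannel x 0)
    + Measure.dirac (rescaleChannel x 1) + Measure.dirac (rescaleChannel x 2))

theorem rescaleChannel_scale {I : Type*} [Fintype I] [Nonempty I]
    (x : I → Fin 3 → ℝ) {a : Fin 3 → ℝ} (ha : ∀ c, 0 < a c) (c : Fin 3) :
    rescaleChannel (fun i c => a c * x i c) c = rescaleChannel x c := by
  funext i c'
  simp only [rescaleChannel, chMax]
  rw [← Finset.mul₀_sup' (ha c).le (fun i => x i c), mul_div_mul_left _ _ (ha c).ne']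

theorem rescaleChannel_CS {I : Type*} [Fintype I] [Nonempty I]
    (x : I → Fin 3 → ℝ) (hx : ∀ c, 0 < chMax x c) (θ : Fin 3 → ℝ) (c : Fin 3) :
    rescaleChannel (CS x θ) c = rescaleChannel x c := by
  have hM : 0 < Finset.univ.sup' Finset.univ_nonempty
      (fun c' : Fin 3 => (2 : ℝ) ^ (θ c') * chMax x c') :=
    (Finset.lt_sup'_iff _).2
      ⟨0, Finset.mem_univ _, mul_pos (Real.rpow_pos_of_pos two_pos _) (hx 0)⟩
  rw [← rescaleChannel_scale x
    (fun c => div_pos (Real.rpow_pos_of_pos two_pos (θ c)) hM) c]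
  congr 1
  funext i c'
  exact mul_div_right_comm _ _ _

theorem random_channel_invariant_under_color_shift
    {I : Type*} [Fintype I] [Nonempty I] :
    (∀ (u : I → ℝ), (∀ i, 0 ≤ u i) →
        0 < Finset.univ.sup' Finset.univ_nonempty u →
        ∀ c : ℝ, 0 < c → ∀ i : I,
          (c * u i) / (Finset.univ.sup' Finset.univ_nonempty fun j => c * u j)
            = u i / Finset.univ.sup' Finset.univ_nonempty u) ∧
    (∀ (x : I → Fin 3 → ℝ), (∀ i c, 0 ≤ x i c) →
        (∀ c : Fin 3, 0 < chMax x c) →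
        ∀ θ : Fin 3 → ℝ, randChannel (CS x θ) = randChannel x) := by
  refine ⟨fun u _ _ c hc i => ?_, fun x _ hx θ => ?_⟩
  · rw [← Finset.mul₀_sup' hc.le u, mul_div_mul_left _ _ hc.ne']
  · simp only [randChannel, rescaleChannel_CS x hx θ]
end
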